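/- Let p be a strictly monotone lattice norm on ℝ² with p((1,0)) = p((0,1)) = 1, and let Φ be an Orlicz function with a(Φ) = 0. Then (E^Φ(μ), ‖·‖_{Φ,p}) is lower locally uniformly monotone: for every y ∈ E^Φ(μ) with y ≥ 0 μ-a.e. and ‖y‖_{Φ,p} = 1, and every ε ∈ (0,1), there exists δ = δ(y,ε) ∈ (0,1) such that every x ∈ E^Φ(μ) with 0 ≤ x ≤ y μ-a.e. and ‖x‖_{Φ,p} ≥ ε satisfies ‖y − x‖_{Φ,p} ≤ 1 − δ. -/

import Mathlib

open MeasureTheory Filter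

noncomputable section

/-- The Orlicz modular `I_Φ(x) = ∫ Φ(x t) dμ` (valued in `[0,∞]`). -/
def Iphi {Ω : Type*} [MeasurableSpace Ω] (μ : Measure Ω) (Φ : ℝ → ℝ) (x : Ω → ℝ) : ENNReal :=
  ∫⁻ t, ENNReal.ofReal (Φ (x t)) ∂μ

/-- One term `(1/k)·p((1, I_Φ(kx)))` of the defining infimum; value `∞` if `I_Φ(kx) = ∞`. -/
def aTerm {Ω : Type*} [MeasurableSpace Ω] (μ : Measure Ω) (Φ : ℝ → ℝ) (p : ℝ × ℝ → ℝ)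
    (x : Ω → ℝ) (k : ℝ) : ENNReal :=
  if Iphi μ Φ (fun t => k * x t) = ⊤ then ⊤
  else ENNReal.ofReal ((1 / k) * p (1, (Iphi μ Φ (fun t => k * x t)).toReal))

/-- The norm `‖x‖_{Φ,p} = inf_{k>0} (1/k)·p((1, I_Φ(kx)))`. -/
def aNorm {Ω : Type*} [MeasurableSpace Ω] (μ : Measure Ω) (Φ : ℝ → ℝ) (p : ℝ × ℝ → ℝ)
    (x : Ω → ℝ) : ENNReal :=
  ⨅ (k : ℝ) (_ : 0 < k), aTerm μ Φ p x k

/-- `Φ` is an Orlicz function: convex, even, vanishing at `0`, nonnegative, not identically `0`. -/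
def IsOrlicz (Φ : ℝ → ℝ) : Prop :=
  ConvexOn ℝ Set.univ Φ ∧ (∀ u, Φ (-u) = Φ u) ∧ Φ 0 = 0 ∧ (∀ u, 0 ≤ Φ u) ∧ ∃ u, Φ u ≠ 0

/-- `p` is a lattice norm on `ℝ²`: a norm which is monotone with respect to the
coordinatewise order on absolute values. -/
def IsLatticeNorm (p : ℝ × ℝ → ℝ) : Prop :=
  (∀ a b : ℝ × ℝ, p (a + b) ≤ p a + p b) ∧ (∀ (c : ℝ) (a : ℝ × ℝ), p (c • a) = |c| * p a) ∧
  (∀ a : ℝ × ℝ, p a = 0 → a = 0) ∧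
  (∀ a b : ℝ × ℝ, |a.1| ≤ |b.1| → |a.2| ≤ |b.2| → p a ≤ p b)

/-- `p` is strictly monotone: `0 ≤ a ≤ b` coordinatewise and `a ≠ b` imply `p a < p b`. -/
def StrictMonoNorm (p : ℝ × ℝ → ℝ) : Prop :=
  ∀ a b : ℝ × ℝ, 0 ≤ a.1 → 0 ≤ a.2 → a.1 ≤ b.1 → a.2 ≤ b.2 → a ≠ b → p a < p b

/-- Membership in the Orlicz space `L^Φ(μ)`. -/
def MemLphi {Ω : Type*} [MeasurableSpace Ω] (μ : Measure Ω) (Φ : ℝ → ℝ) (x : Ω → ℝ) : Prop :=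
  Measurable x ∧ ∃ l : ℝ, 0 < l ∧ Iphi μ Φ (fun t => l * x t) ≠ ⊤

/-- Membership in the space `E^Φ(μ)` of order continuous elements. -/
def MemEphi {Ω : Type*} [MeasurableSpace Ω] (μ : Measure Ω) (Φ : ℝ → ℝ) (x : Ω → ℝ) : Prop :=
  Measurable x ∧ ∀ l : ℝ, 0 < l → Iphi μ Φ (fun t => l * x t) ≠ ⊤

/-- `a(Φ) = sup{u ≥ 0 : Φ(u) = 0}`. -/
def aPhi (Φ : ℝ → ℝ) : ℝ := sSup {u : ℝ | 0 ≤ u ∧ Φ u = 0}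

/-- `K(x) = {k > 0 : ‖x‖_{Φ,p} = (1/k)·p((1, I_Φ(kx)))}`. -/
def Kset {Ω : Type*} [MeasurableSpace Ω] (μ : Measure Ω) (Φ : ℝ → ℝ) (p : ℝ × ℝ → ℝ)
    (x : Ω → ℝ) : Set ℝ :=
  {k : ℝ | 0 < k ∧ aNorm μ Φ p x = aTerm μ Φ p x k}

/-- Condition `Δ₂(ℝ₊)`: `Φ(2u) ≤ K·Φ(u)` for all `u ≥ 0`. -/
def Delta2 (Φ : ℝ → ℝ) : Prop := ∃ K : ℝ, 0 < K ∧ ∀ u : ℝ, 0 ≤ u → Φ (2 * u) ≤ K * Φ u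

/-- A non-atomic measure: every set of positive measure has a measurable subset of
strictly smaller positive measure. -/
def NonAtomic {Ω : Type*} [MeasurableSpace Ω] (μ : Measure Ω) : Prop :=
  ∀ A : Set Ω, MeasurableSet A → 0 < μ A →
    ∃ B ⊆ A, MeasurableSet B ∧ 0 < μ B ∧ μ B < μ A

/-- The modulus of monotonicity of `(ℝ², p)`:
`δ_{m,p}(ε) = inf{1 − p(b − a) : 0 ≤ a ≤ b coordinatewise, p a ≥ ε, p b = 1}`. -/
def deltaM (p : ℝ × ℝ → ℝ) (ε : ℝ) : ℝ :=
  sInf {d : ℝ | ∃ a b : ℝ × ℝ, 0 ≤ a.1 ∧ 0 ≤ a.2 ∧ a.1 ≤ b.1 ∧ a.2 ≤ b.2 ∧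
    ε ≤ p a ∧ p b = 1 ∧ d = 1 - p (b - a)}

/-- Superadditivity at `0` of a convex function on `[0, ∞)`. -/
lemma ConvexOn.sub_add_le_add_zero {f : ℝ → ℝ} (hf : ConvexOn ℝ (Set.Ici 0) f) {a b : ℝ}
    (hb : 0 ≤ b) (hba : b ≤ a) : f (a - b) + f b ≤ f a + f 0 := by
  rcases (hb.trans hba).eq_or_lt with ha | ha
  · obtain rfl : b = a := by linarith
    simp [← ha]
  have hr : 0 ≤ b / a := by positivity
  have hr' : 0 ≤ 1 - b / a := by rw [sub_nonneg, div_le_one ha]; exact hba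
  have h1 := hf.2 (Set.mem_Ici.2 ha.le) Set.self_mem_Ici hr hr' (by ring)
  have h2 := hf.2 (Set.mem_Ici.2 ha.le) Set.self_mem_Ici hr' hr (by ring)
  have e1 : b / a * a = b := by field_simp
  have e2 : (1 - b / a) * a = a - b := by field_simp
  simp only [smul_eq_mul, mul_zero, add_zero, e1, e2] at h1 h2
  linarith

namespace IsOrlicz

variable {Φ : ℝ → ℝ}

lemma continuous (hΦ : IsOrlicz Φ) : Continuous Φ :=
  continuousOn_univ.1 (hΦ.1.continuousOn isOpen_univ)

lemma sub_add_le (hΦ : IsOrlicz Φ) {a b : ℝ} (hb : 0 ≤ b) (hba : b ≤ a) :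
    Φ (a - b) + Φ b ≤ Φ a := by
  simpa [hΦ.2.2.1] using
    (hΦ.1.subset (Set.subset_univ _) (convex_Ici 0)).sub_add_le_add_zero hb hba

lemma mono (hΦ : IsOrlicz Φ) {a b : ℝ} (hb : 0 ≤ b) (hba : b ≤ a) : Φ b ≤ Φ a := by
  have := hΦ.sub_add_le hb hba
  linarith [hΦ.2.2.2.1 (a - b)]

lemma pos_of_aPhi_eq_zero (hΦ : IsOrlicz Φ) (ha : aPhi Φ = 0) {u : ℝ} (hu : 0 < u) :
    0 < Φ u := by
  refine (hΦ.2.2.2.1 u).lt_of_ne' fun h => ?_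
  obtain ⟨v, hv⟩ := hΦ.2.2.2.2
  have hv' : Φ |v| ≠ 0 := by
    rcases abs_choice v with h | h <;> simpa [h, hΦ.2.1] using hv
  have hbdd : BddAbove {u : ℝ | 0 ≤ u ∧ Φ u = 0} := by
    refine ⟨|v|, fun w hw => ?_⟩
    by_contra! hlt
    exact hv' (le_antisymm ((hΦ.mono (abs_nonneg v) hlt.le).trans_eq hw.2) (hΦ.2.2.2.1 _))
  have : u ≤ aPhi Φ := le_csSup hbdd ⟨hu.le, h⟩
  linarith

end IsOrlicz

namespace IsLatticeNorm

variable {p : ℝ × ℝ → ℝ}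

lemma convexOn_section (hp : IsLatticeNorm p) :
    ConvexOn ℝ (Set.Ici 0) fun s => p (1, s) := by
  refine ⟨convex_Ici 0, fun s _ t _ a b ha hb hab => ?_⟩
  have h := hp.1 (a • ((1 : ℝ), s)) (b • ((1 : ℝ), t))
  rw [hp.2.1, hp.2.1, abs_of_nonneg ha, abs_of_nonneg hb] at h
  simpa [hab] using h

lemma section_mono (hp : IsLatticeNorm p) {s t : ℝ} (hs : 0 ≤ s) (hst : s ≤ t) :
    p (1, s) ≤ p (1, t) :=
  hp.2.2.2 _ _ le_rfl (by simpa [abs_of_nonneg hs, abs_of_nonneg (hs.trans hst)] using hst)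

lemma section_le_one_add (hp : IsLatticeNorm p) (h10 : p (1, 0) = 1) (h01 : p (0, 1) = 1)
    {s : ℝ} (hs : 0 ≤ s) : p (1, s) ≤ 1 + s := by
  have h := hp.1 (1, 0) (s • (0, 1))
  rw [hp.2.1, h10, h01, abs_of_nonneg hs] at h
  simpa using h

end IsLatticeNorm

section Modular

variable {Ω : Type*} [MeasurableSpace Ω] {μ : Measure Ω} {Φ : ℝ → ℝ} {p : ℝ × ℝ → ℝ}
  {x y : Ω → ℝ}

lemma aTerm_of_memEphi (hx : MemEphi μ Φ x) {k : ℝ} (hk : 0 < k) :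
    aTerm μ Φ p x k =
      ENNReal.ofReal ((1 / k) * p (1, (Iphi μ Φ (fun t => k * x t)).toReal)) :=
  if_neg (hx.2 k hk)

lemma aNorm_le_of_memEphi (hx : MemEphi μ Φ x) {k : ℝ} (hk : 0 < k) :
    aNorm μ Φ p x ≤
      ENNReal.ofReal ((1 / k) * p (1, (Iphi μ Φ (fun t => k * x t)).toReal)) :=
  (iInf₂_le k hk).trans_eq (aTerm_of_memEphi hx hk)

lemma Iphi_mul_mono (hΦ : IsOrlicz Φ) (hxy : ∀ᵐ t ∂μ, 0 ≤ x t ∧ x t ≤ y t) {k l : ℝ}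
    (hk : 0 ≤ k) (hkl : k ≤ l) :
    Iphi μ Φ (fun t => k * x t) ≤ Iphi μ Φ (fun t => l * y t) := by
  refine lintegral_mono_ae (hxy.mono fun t ht => ENNReal.ofReal_le_ofReal ?_)
  exact hΦ.mono (mul_nonneg hk ht.1) (mul_le_mul hkl ht.2 ht.1 (hk.trans hkl))

lemma Iphi_mul_sub_add_le (hΦ : IsOrlicz Φ) (hx : Measurable x)
    (hxy : ∀ᵐ t ∂μ, 0 ≤ x t ∧ x t ≤ y t) {k : ℝ} (hk : 0 ≤ k) :
    Iphi μ Φ (fun t => k * (y t - x t)) + Iphi μ Φ (fun t => k * x t) ≤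
      Iphi μ Φ (fun t => k * y t) := by
  have hm : Measurable fun t => ENNReal.ofReal (Φ (k * x t)) :=
    (hΦ.continuous.measurable.comp (hx.const_mul k)).ennreal_ofReal
  unfold Iphi
  rw [← lintegral_add_right _ hm]
  refine lintegral_mono_ae (hxy.mono fun t ht => ?_)
  rw [← ENNReal.ofReal_add (hΦ.2.2.2.1 _) (hΦ.2.2.2.1 _)]
  simp only [mul_sub]
  exact ENNReal.ofReal_le_ofReal
    (hΦ.sub_add_le (mul_nonneg hk ht.1) (mul_le_mul_of_nonneg_left ht.2 hk))

lemma MemEphi.sub (hΦ : IsOrlicz Φ) (hy : MemEphi μ Φ y) (hx : Measurable x)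
    (hxy : ∀ᵐ t ∂μ, 0 ≤ x t ∧ x t ≤ y t) : MemEphi μ Φ (fun t => y t - x t) := by
  refine ⟨hy.1.sub hx, fun l hl => ne_top_of_le_ne_top (hy.2 l hl) ?_⟩
  exact le_self_add.trans (Iphi_mul_sub_add_le hΦ hx hxy hl.le)

lemma tendsto_zero_of_tendsto_orlicz (hΦ : IsOrlicz Φ) (ha : aPhi Φ = 0) {c : ℝ} (hc : 0 < c)
    {u : ℕ → ℝ} (hu : ∀ n, 0 ≤ u n)
    (h : Tendsto (fun n => ENNReal.ofReal (Φ (c * u n))) atTop (nhds 0)) :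
    Tendsto u atTop (nhds 0) := by
  refine tendsto_order.2 ⟨fun e he => .of_forall fun n => he.trans_le (hu n), fun e he => ?_⟩
  have hpos := hΦ.pos_of_aPhi_eq_zero ha (mul_pos hc he)
  filter_upwards [h.eventually_lt_const (ENNReal.ofReal_pos.2 hpos)] with n hn
  by_contra! hle
  exact hn.not_ge (ENNReal.ofReal_le_ofReal
    (hΦ.mono (mul_pos hc he).le (mul_le_mul_of_nonneg_left hle hc.le)))

/-- On the order interval `[0, y]`, with `y ∈ E^Φ`, the modular is bounded away from `0` on
elements whose norm is bounded away from `0`. -/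
lemma exists_pos_le_Iphi (hΦ : IsOrlicz Φ) (ha : aPhi Φ = 0) (hp : IsLatticeNorm p)
    (h10 : p (1, 0) = 1) (h01 : p (0, 1) = 1) (hy : MemEphi μ Φ y) {ε c : ℝ} (hε : 0 < ε)
    (hc : 0 < c) :
    ∃ η : ENNReal, 0 < η ∧ ∀ x : Ω → ℝ, MemEphi μ Φ x → (∀ᵐ t ∂μ, 0 ≤ x t ∧ x t ≤ y t) →
      ENNReal.ofReal ε ≤ aNorm μ Φ p x → η ≤ Iphi μ Φ (fun t => c * x t) := by
  by_contra! hcon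
  obtain ⟨η, hη, hηsum⟩ := ENNReal.exists_pos_sum_of_countable one_ne_zero ℕ
  choose x hxE hxy hxε hxη using fun n => hcon (η n) (ENNReal.coe_pos.2 (hη n))
  have hmeas (l : ℝ) (n : ℕ) : Measurable fun t => ENNReal.ofReal (Φ (l * x n t)) :=
    (hΦ.continuous.measurable.comp ((hxE n).1.const_mul l)).ennreal_ofReal
  have hsum : ∫⁻ t, ∑' n, ENNReal.ofReal (Φ (c * x n t)) ∂μ ≠ ⊤ := by
    rw [lintegral_tsum fun n => (hmeas c n).aemeasurable]
    exact ((ENNReal.tsum_le_tsum fun n => (hxη n).le).trans_lt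
      (hηsum.trans ENNReal.one_lt_top)).ne
  have hae : ∀ᵐ t ∂μ, Tendsto (fun n => x n t) atTop (nhds 0) := by
    filter_upwards [ae_lt_top (Measurable.tsum (hmeas c)) hsum, ae_all_iff.2 hxy]
      with t ht hxt
    exact tendsto_zero_of_tendsto_orlicz hΦ ha hc (fun n => (hxt n).1)
      (ENNReal.tendsto_atTop_zero_of_tsum_ne_top ht.ne)
  have hl : 0 < 2 / ε := by positivity
  have hlim : Tendsto (fun n => Iphi μ Φ (fun t => 2 / ε * x n t)) atTop (nhds 0) := by
    have h := tendsto_lintegral_of_dominated_convergence (μ := μ) (f := fun _ => 0)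
      (fun t => ENNReal.ofReal (Φ (2 / ε * y t))) (hmeas (2 / ε))
      (fun n => (hxy n).mono fun t ht => ENNReal.ofReal_le_ofReal
        (hΦ.mono (mul_nonneg hl.le ht.1) (mul_le_mul_of_nonneg_left ht.2 hl.le)))
      (hy.2 _ hl) (hae.mono fun t ht => by
        have h := ENNReal.tendsto_ofReal
          ((hΦ.continuous.tendsto _).comp (ht.const_mul (2 / ε)))
        simpa [hΦ.2.2.1] using h)
    simpa [Iphi] using h
  obtain ⟨n, hn⟩ := (hlim.eventually_lt_const one_pos).exists
  have hn' := (ENNReal.toReal_lt_toReal ((hxE n).2 _ hl) ENNReal.one_ne_top).2 hn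
  rw [ENNReal.toReal_one] at hn'
  have h1 := (hxε n).trans (aNorm_le_of_memEphi (hxE n) hl)
  have hq := hp.section_le_one_add h10 h01
    (ENNReal.toReal_nonneg (a := Iphi μ Φ (fun t => 2 / ε * x n t)))
  refine h1.not_gt ((ENNReal.ofReal_lt_ofReal_iff hε).2 ?_)
  rw [one_div_div]
  nlinarith

lemma aNorm_sub_le (hΦ : IsOrlicz Φ) (hp : IsLatticeNorm p) (h10 : p (1, 0) = 1)
    (hy : MemEphi μ Φ y) (hx : MemEphi μ Φ x) (hxy : ∀ᵐ t ∂μ, 0 ≤ x t ∧ x t ≤ y t)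
    {k : ℝ} (hk : 0 < k) :
    aNorm μ Φ p (fun t => y t - x t) ≤ ENNReal.ofReal
      ((1 / k) * p (1, (Iphi μ Φ (fun t => k * y t)).toReal) -
        (1 / k) * (p (1, (Iphi μ Φ (fun t => k * x t)).toReal) - 1)) := by
  have hyx := hy.sub hΦ hx.1 hxy
  refine (aNorm_le_of_memEphi hyx hk).trans (ENNReal.ofReal_le_ofReal ?_)
  rw [← mul_sub]
  refine mul_le_mul_of_nonneg_left ?_ (by positivity)
  have hI := ENNReal.toReal_mono (hy.2 k hk) (Iphi_mul_sub_add_le hΦ hx.1 hxy hk.le)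
  rw [ENNReal.toReal_add (hyx.2 k hk) (hx.2 k hk)] at hI
  have hle := ENNReal.toReal_mono (hy.2 k hk) (Iphi_mul_mono hΦ hxy hk.le le_rfl)
  have h1 := hp.section_mono ENNReal.toReal_nonneg (le_sub_right_of_add_le hI)
  have h2 := hp.convexOn_section.sub_add_le_add_zero ENNReal.toReal_nonneg hle
  simp only [h10] at h2
  linarith

end Modular

/-- If `p` is a strictly monotone lattice norm on `ℝ²` with `p (1,0) = p (0,1) = 1` and `Φ` is
an Orlicz function with `a(Φ) = 0`, then `(E^Φ(μ), ‖·‖_{Φ,p})` is lower locally uniformly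
monotone. -/
theorem stmt12 {Ω : Type*} [MeasurableSpace Ω] (μ : Measure Ω) [SigmaFinite μ]
    (Φ : ℝ → ℝ) (hΦ : IsOrlicz Φ) (ha : aPhi Φ = 0)
    (p : ℝ × ℝ → ℝ) (hp : IsLatticeNorm p) (hpm : StrictMonoNorm p)
    (h10 : p (1, 0) = 1) (h01 : p (0, 1) = 1)
    (y : Ω → ℝ) (hy : MemEphi μ Φ y) (hy0 : ∀ᵐ t ∂μ, 0 ≤ y t)
    (hny : aNorm μ Φ p y = 1) (ε : ℝ) (hε : ε ∈ Set.Ioo (0 : ℝ) 1) :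
    ∃ δ ∈ Set.Ioo (0 : ℝ) 1, ∀ x : Ω → ℝ, MemEphi μ Φ x →
      (∀ᵐ t ∂μ, 0 ≤ x t ∧ x t ≤ y t) → ENNReal.ofReal ε ≤ aNorm μ Φ p x →
      aNorm μ Φ p (fun t => y t - x t) ≤ ENNReal.ofReal (1 - δ) := by
  obtain ⟨hε0, hε1⟩ := hε
  obtain ⟨η, hη0, hη⟩ := exists_pos_le_Iphi hΦ ha hp h10 h01 hy hε0 (one_half_pos (α := ℝ))
  set θ := (min η 1).toReal
  have hθtop : min η 1 ≠ ⊤ := (min_lt_of_right_lt ENNReal.one_lt_top).ne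
  have hθ0 : 0 < θ := ENNReal.toReal_pos (lt_min hη0 one_pos).ne' hθtop
  have hq : 1 < p (1, θ) := h10.symm.trans_lt
    (hpm (1, 0) (1, θ) zero_le_one le_rfl le_rfl hθ0.le (by simpa using hθ0.ne))
  have hgap : 0 < ε / 4 * (p (1, θ) - 1) := mul_pos (by positivity) (sub_pos.2 hq)
  refine ⟨min (ε / 2) (ε / 4 * (p (1, θ) - 1)), ⟨lt_min (by positivity) hgap,
    min_lt_of_left_lt (by linarith)⟩, fun x hx hxy hεx => ?_⟩
  set δ := min (ε / 2) (ε / 4 * (p (1, θ) - 1))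
  have hδ : δ ≤ ε / 2 := min_le_left _ _
  have hδ' : δ ≤ ε / 4 * (p (1, θ) - 1) := min_le_right _ _
  refine ENNReal.le_of_forall_pos_le_add fun r hr _ => ?_
  set τ : ℝ := min r 1
  have hτ0 : 0 < τ := lt_min hr one_pos
  have hlt : aNorm μ Φ p y < ENNReal.ofReal (1 + τ) := by
    rw [hny, ← ENNReal.ofReal_one, ENNReal.ofReal_lt_ofReal_iff (by linarith)]
    linarith
  simp only [aNorm, iInf_lt_iff] at hlt
  obtain ⟨k, hk, hlt⟩ := hlt
  rw [aTerm_of_memEphi hy hk, ENNReal.ofReal_lt_ofReal_iff (by linarith)] at hlt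
  have hk2 : 1 / 2 ≤ k := by
    have h1 := hp.section_mono le_rfl
      (ENNReal.toReal_nonneg (a := Iphi μ Φ (fun t => k * y t)))
    rw [h10] at h1
    have h2 := (mul_le_mul_of_nonneg_left h1 (one_div_pos.2 hk).le).trans_lt hlt
    have h3 : 1 / k < 2 := by linarith [min_le_right (r : ℝ) 1]
    rw [div_lt_iff₀ hk] at h3
    linarith
  set s := (Iphi μ Φ (fun t => k * x t)).toReal
  have hgain : δ ≤ 1 / k * (p (1, s) - 1) := by
    rw [one_div_mul_eq_div, le_div_iff₀ hk]
    rcases le_total k (4 / ε) with hkε | hkε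
    · rw [le_div_iff₀ hε0] at hkε
      have hθs : θ ≤ s := by
        refine ENNReal.toReal_mono (hx.2 k hk) ((min_le_left _ _).trans ((hη x hx hxy hεx).trans ?_))
        exact Iphi_mul_mono hΦ (hxy.mono fun t ht => ⟨ht.1, le_rfl⟩) one_half_pos.le hk2
      have := hp.section_mono hθ0.le hθs
      nlinarith
    · rw [div_le_iff₀ hε0] at hkε
      have h1 := hεx.trans (aNorm_le_of_memEphi hx hk)
      have h2 : ε ≤ 1 / k * p (1, s) :=
        (ENNReal.ofReal_le_ofReal_iff' .. |>.1 h1).resolve_right hε0.not_ge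
      rw [one_div_mul_eq_div, le_div_iff₀ hk] at h2
      nlinarith
  refine (aNorm_sub_le hΦ hp h10 hy hx hxy hk).trans ?_
  rw [← ENNReal.ofReal_coe_nnreal, ← ENNReal.ofReal_add (by linarith) r.coe_nonneg]
  refine ENNReal.ofReal_le_ofReal ?_
  have : τ ≤ r := min_le_left _ _
  linarith
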